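/- Let X be a random vector in ℝ^n distributed according to an unconditional measure, and let M_n = ‖ ‖X‖_{ℓ_2^n} ‖_{L_∞} < ∞. If G = (g_1,...,g_n) is a standard Gaussian vector independent of X, then E_G ‖⟨G, X⟩‖_{ψ_2(X)} computed as follows holds: there is an absolute constant c such that E_G ‖⟨G,·⟩/(c M_n)‖_{ψ_2} ≤ 2; consequently, for every ε > 0, log N(B_2^n, ε B_{ψ_2}) ≤ C M_n^2/ε^2, where B_{ψ_2} = {v ∈ ℝ^n : ‖⟨v,·⟩‖_{ψ_2} ≤ 1} and N(K,L) is the covering number. -/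

import Mathlib

open MeasureTheory ProbabilityTheory

/-- The `ψ₂` (subgaussian) norm of a function `f` with respect to a measure `μ`. -/
noncomputable def psiTwoNorm {α : Type*} [MeasurableSpace α] (μ : Measure α)
    (f : α → ℝ) : ℝ :=
  sInf {c : ℝ | 0 < c ∧ ∫ x, Real.exp (f x ^ 2 / c ^ 2) ∂μ ≤ 2}

/-- A measure `μ` on `ℝ^n` is unconditional if it is invariant under sign flips of
the coordinates. -/
def IsUncondMeasure {n : ℕ} (μ : Measure (Fin n → ℝ)) : Prop :=
  ∀ s : Fin n → ℝ, (∀ i, s i = 1 ∨ s i = -1) →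
    Measure.map (fun x i => s i * x i) μ = μ

/-- The standard Gaussian measure on `Fin n → ℝ`. -/
noncomputable abbrev stdGaussianPi (n : ℕ) : Measure (Fin n → ℝ) :=
  Measure.pi fun _ : Fin n => gaussianReal 0 1

theorem gaussianReal_eq_withDensity_exp (a : ℝ) :
    gaussianReal a 1 =
      (gaussianReal 0 1).withDensity fun y => ENNReal.ofReal (Real.exp (a * y - a ^ 2 / 2)) := by
  rw [gaussianReal_of_var_ne_zero _ one_ne_zero, gaussianReal_of_var_ne_zero _ one_ne_zero,
    ← withDensity_mul _ (measurable_gaussianPDF _ _) (by fun_prop)]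
  congr 1
  ext y
  simp only [Pi.mul_apply, gaussianPDF, gaussianPDFReal]
  rw [← ENNReal.ofReal_mul (by positivity), mul_assoc _ (Real.exp _), ← Real.exp_add]
  congr 3
  simp only [NNReal.coe_one]
  ring

theorem stdGaussianPi_map_add {n : ℕ} (h : Fin n → ℝ) :
    (stdGaussianPi n).map (fun y => y + h) =
      (stdGaussianPi n).withDensity
        fun y => ∏ i, ENNReal.ofReal (Real.exp (h i * y i - h i ^ 2 / 2)) := by
  have h1 : (stdGaussianPi n).map (fun y => y + h) =
      Measure.pi fun i => gaussianReal (h i) 1 := by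
    have := Measure.pi_map_pi (μ := fun _ : Fin n => gaussianReal 0 1)
      (f := fun i y => y + h i)
      (hμ := fun i => by rw [gaussianReal_map_add_const]; infer_instance)
      (fun i => by fun_prop)
    simp only [gaussianReal_map_add_const, zero_add] at this
    exact this
  rw [h1]
  refine Measure.pi_eq fun s hs => ?_
  rw [withDensity_apply _ (MeasurableSet.univ_pi hs),
    ← lintegral_indicator (MeasurableSet.univ_pi hs)]
  set f : (i : Fin n) → ℝ → ENNReal := fun i =>
    (s i).indicator fun y => ENNReal.ofReal (Real.exp (h i * y - h i ^ 2 / 2))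
  have hfm : ∀ i, Measurable (f i) := fun i => Measurable.indicator (by fun_prop) (hs i)
  have h2 : (Set.univ.pi s).indicator
      (fun y => ∏ i, ENNReal.ofReal (Real.exp (h i * y i - h i ^ 2 / 2))) =
      fun y => ∏ i, f i (y i) := by
    ext y
    by_cases hy : y ∈ Set.univ.pi s
    · rw [Set.indicator_of_mem hy]
      refine Finset.prod_congr rfl fun i _ => ?_
      have h0 : f i (y i) = ENNReal.ofReal (Real.exp (h i * y i - h i ^ 2 / 2)) :=
        Set.indicator_of_mem (hy i (Set.mem_univ i)) _
      exact h0.symm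
    · rw [Set.indicator_of_notMem hy]
      simp only [Set.mem_pi, Set.mem_univ, true_imp_iff, not_forall] at hy
      obtain ⟨i, hi⟩ := hy
      have h0 : f i (y i) = 0 := Set.indicator_of_notMem hi _
      exact (Finset.prod_eq_zero (Finset.mem_univ i) h0).symm
  rw [h2, lintegral_prod_eq_prod_lintegral_of_indepFun Finset.univ
    (fun i (y : Fin n → ℝ) => f i (y i))
    (iIndepFun_pi fun i => (hfm i).aemeasurable)
    (fun i => (hfm i).comp (measurable_pi_apply i))]
  refine Finset.prod_congr rfl fun i _ => ?_
  rw [gaussianReal_eq_withDensity_exp (h i), withDensity_apply _ (hs i), ← lintegral_indicator (hs i)]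
  exact (measurePreserving_eval (fun _ : Fin n => gaussianReal 0 1) i).lintegral_comp (hfm i)

theorem stdGaussianPi_measurePreserving_neg (n : ℕ) :
    MeasurePreserving (fun y : Fin n → ℝ => -y) (stdGaussianPi n) (stdGaussianPi n) := by
  refine ⟨by fun_prop, ?_⟩
  have := Measure.pi_map_pi (μ := fun _ : Fin n => gaussianReal 0 1)
    (f := fun _ y => -y)
    (hμ := fun i => by rw [gaussianReal_map_neg]; infer_instance)
    (fun i => by fun_prop)
  simp only [gaussianReal_map_neg, neg_zero] at this
  exact this

/-- The Gaussian measure of a translate of a symmetric set. -/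
theorem exp_mul_stdGaussianPi_le_shift {n : ℕ} {S : Set (Fin n → ℝ)} (hS : MeasurableSet S)
    (hsymm : ∀ y ∈ S, -y ∈ S) (h : Fin n → ℝ) :
    ENNReal.ofReal (Real.exp (-(∑ i, h i ^ 2) / 2)) * stdGaussianPi n S ≤
      stdGaussianPi n ((fun y => y + h) ⁻¹' S) := by
  have key (h : Fin n → ℝ) : stdGaussianPi n ((fun y => y + h) ⁻¹' S) =
      ∫⁻ y in S, ENNReal.ofReal (Real.exp (∑ i, h i * y i - (∑ i, h i ^ 2) / 2))
        ∂(stdGaussianPi n) := by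
    rw [← Measure.map_apply (by fun_prop) hS, stdGaussianPi_map_add, withDensity_apply _ hS]
    refine lintegral_congr fun y => ?_
    rw [← ENNReal.ofReal_prod_of_nonneg (fun _ _ => (Real.exp_pos _).le), ← Real.exp_sum,
      Finset.sum_sub_distrib, Finset.sum_div]
  have hneg : stdGaussianPi n ((fun y => y + -h) ⁻¹' S) =
      stdGaussianPi n ((fun y => y + h) ⁻¹' S) := by
    rw [← (stdGaussianPi_measurePreserving_neg n).measure_preimage
      ((hS.preimage (by fun_prop)).nullMeasurableSet)]
    congr 1
    ext y
    simp only [Set.mem_preimage]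
    constructor
    · intro hy
      simpa [add_comm] using hsymm _ hy
    · intro hy
      simpa [add_comm] using hsymm _ hy
  have hsum : 2 * (ENNReal.ofReal (Real.exp (-(∑ i, h i ^ 2) / 2)) * stdGaussianPi n S) ≤
      2 * stdGaussianPi n ((fun y => y + h) ⁻¹' S) := by
    calc _ = ∫⁻ y in S, 2 * ENNReal.ofReal (Real.exp (-(∑ i, h i ^ 2) / 2))
          ∂(stdGaussianPi n) := by rw [setLIntegral_const, mul_assoc]
      _ ≤ ∫⁻ y in S, (ENNReal.ofReal (Real.exp (∑ i, h i * y i - (∑ i, h i ^ 2) / 2)) +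
            ENNReal.ofReal (Real.exp (∑ i, (-h) i * y i - (∑ i, (-h) i ^ 2) / 2)))
          ∂(stdGaussianPi n) := by
        refine lintegral_mono fun y => ?_
        rw [← ENNReal.ofReal_add (by positivity) (by positivity),
          ← ENNReal.ofReal_ofNat 2, ← ENNReal.ofReal_mul (by norm_num)]
        refine ENNReal.ofReal_le_ofReal ?_
        simp only [Pi.neg_apply, neg_mul, Finset.sum_neg_distrib, neg_sq]
        have := Real.one_le_cosh (∑ i, h i * y i)
        rw [Real.cosh_eq] at this
        rw [sub_eq_add_neg, sub_eq_add_neg, Real.exp_add, Real.exp_add, ← neg_div]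
        nlinarith [Real.exp_pos (-(∑ i, h i ^ 2) / 2)]
      _ = _ := by
        rw [lintegral_add_left (by fun_prop), ← key, ← key, hneg, two_mul]
  exact (ENNReal.mul_le_mul_iff_right (by norm_num) (by norm_num)).1 hsum

/-- The dual Sudakov packing bound for a symmetric convex set. -/
theorem exists_cover_of_convex_symmetric {n : ℕ} {S : Set (Fin n → ℝ)} (hS : MeasurableSet S)
    (hsymm : ∀ y ∈ S, -y ∈ S) (hconv : Convex ℝ S) (hpos : 1 / 4 ≤ (stdGaussianPi n).real S)
    (t : ℝ) :
    ∃ T : Finset (Fin n → ℝ), (T.card : ℝ) ≤ 4 * Real.exp (t ^ 2 / 2) ∧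
      ∀ x, ∑ i, x i ^ 2 ≤ 1 → ∃ y ∈ T, (t / 2) • (x - y) ∈ S := by
  classical
  let P : Finset (Fin n → ℝ) → Prop := fun T =>
    (∀ x ∈ T, ∑ i, x i ^ 2 ≤ 1) ∧
      (T : Set (Fin n → ℝ)).Pairwise fun x y => (t / 2) • (x - y) ∉ S
  have hcard : ∀ T, P T → (T.card : ℝ) ≤ 4 * Real.exp (t ^ 2 / 2) := by
    rintro T ⟨hT, hsep⟩
    have hdisj : (T : Set (Fin n → ℝ)).PairwiseDisjoint
        fun x => (fun y => y + t • x) ⁻¹' S := by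
      intro x hx y hy hxy
      rw [Function.onFun, Set.disjoint_left]
      intro z hz hz'
      refine hsep hx hy hxy ?_
      have := hconv hz (hsymm _ hz') (a := 1 / 2) (b := 1 / 2)
        (by norm_num) (by norm_num) (by norm_num)
      convert this using 1
      module
    have hle : ∑ x ∈ T, (stdGaussianPi n).real ((fun y => y + t • x) ⁻¹' S) ≤ 1 := by
      rw [← measureReal_biUnion_finset hdisj fun x _ => hS.preimage (by fun_prop)]
      exact measureReal_le_one
    have hlow : ∀ x ∈ T, Real.exp (-t ^ 2 / 2) * (1 / 4) ≤
        (stdGaussianPi n).real ((fun y => y + t • x) ⁻¹' S) := by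
      intro x hx
      have h1 := ENNReal.toReal_mono (measure_ne_top _ _)
        (exp_mul_stdGaussianPi_le_shift hS hsymm (t • x))
      rw [ENNReal.toReal_mul, ENNReal.toReal_ofReal (by positivity)] at h1
      refine le_trans ?_ h1
      refine mul_le_mul (Real.exp_le_exp.2 ?_) hpos (by norm_num) (by positivity)
      simp only [Pi.smul_apply, smul_eq_mul, mul_pow, ← Finset.mul_sum]
      nlinarith [hT x hx, sq_nonneg t]
    have h2 := (Finset.card_nsmul_le_sum T _ _ hlow).trans hle
    rw [nsmul_eq_mul, neg_div, Real.exp_neg] at h2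
    have h3 := Real.exp_pos (t ^ 2 / 2)
    field_simp at h2
    linarith
  obtain ⟨N, hN⟩ := exists_nat_ge (4 * Real.exp (t ^ 2 / 2))
  have hbdd : ∀ m, (∃ T, P T ∧ T.card = m) → m ≤ N := by
    rintro m ⟨T, hT, rfl⟩
    exact_mod_cast (hcard T hT).trans hN
  have hex : ∃ m, ∃ T, P T ∧ T.card = m := ⟨0, ∅, by simp [P], rfl⟩
  obtain ⟨m, ⟨T, hT, hTm⟩, hmax⟩ :
      ∃ m, (∃ T, P T ∧ T.card = m) ∧ ∀ k, (∃ T, P T ∧ T.card = k) → k ≤ m := by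
    obtain ⟨m, hm⟩ := hex
    exact ⟨_, Nat.findGreatest_spec (P := fun m => ∃ T, P T ∧ T.card = m) (hbdd m hm) hm,
      fun k hk => Nat.le_findGreatest (hbdd k hk) hk⟩
  refine ⟨T, hcard T hT, fun x hx => ?_⟩
  by_contra! hcon
  have h0 : (0 : Fin n → ℝ) ∈ S := by
    have hne : S.Nonempty := by
      by_contra hne
      rw [Set.not_nonempty_iff_eq_empty] at hne
      rw [hne] at hpos
      norm_num at hpos
    obtain ⟨y, hy⟩ := hne
    have := hconv hy (hsymm _ hy) (a := 1 / 2) (b := 1 / 2)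
      (by norm_num) (by norm_num) (by norm_num)
    simpa using this
  have hxT : x ∉ T := fun h => hcon x h (by simpa using h0)
  have hins : P (insert x T) := by
    refine ⟨?_, ?_⟩
    · intro y hy
      rcases Finset.mem_insert.1 hy with rfl | hy
      exacts [hx, hT.1 y hy]
    · rw [Finset.coe_insert]
      refine hT.2.insert fun y hy _ => ⟨hcon y hy, fun h => hcon y hy ?_⟩
      have := hsymm _ h
      rwa [← smul_neg, neg_sub] at this
  have := hmax _ ⟨_, hins, rfl⟩
  rw [Finset.card_insert_of_notMem hxT] at this
  omega

theorem stdGaussianPi_map_sum_mul {n : ℕ} (w : Fin n → ℝ) :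
    (stdGaussianPi n).map (fun g => ∑ i, g i * w i) =
      (gaussianReal 0 1).map fun y => √(∑ i, w i ^ 2) * y := by
  have hnn : 0 ≤ ∑ i, w i ^ 2 := Finset.sum_nonneg fun i _ => sq_nonneg _
  rw [gaussianReal_map_const_mul]
  have := Measure.isProbabilityMeasure_map (μ := stdGaussianPi n)
    (f := fun g => ∑ i, g i * w i) (Measurable.aemeasurable (by fun_prop))
  refine Measure.ext_of_charFun ?_
  ext t
  rw [charFun_apply_real, charFun_gaussianReal, integral_map
    (Measurable.aemeasurable (by fun_prop)) (by fun_prop)]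
  have h1 (g : Fin n → ℝ) : Complex.exp (t * ((∑ i, g i * w i : ℝ) : ℂ) * Complex.I) =
      ∏ i, Complex.exp (((t * w i : ℝ) : ℂ) * (g i : ℂ) * Complex.I) := by
    rw [← Complex.exp_sum]
    push_cast
    rw [Finset.mul_sum, Finset.sum_mul]
    congr 1
    exact Finset.sum_congr rfl fun i _ => by ring
  simp_rw [h1]
  rw [integral_fintype_prod_eq_prod
    (fun i (y : ℝ) => Complex.exp (((t * w i : ℝ) : ℂ) * (y : ℂ) * Complex.I))]
  simp_rw [← charFun_apply_real, charFun_gaussianReal]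
  rw [← Complex.exp_sum]
  congr 1
  simp only [mul_one, NNReal.coe_mk, Real.sq_sqrt hnn]
  push_cast
  simp only [mul_zero, zero_mul, zero_sub, one_mul, Finset.sum_neg_distrib, ← Finset.sum_div,
    mul_pow, ← Finset.mul_sum]
  ring

theorem lintegral_exp_sq_div_four_gaussianReal :
    ∫⁻ y, ENNReal.ofReal (Real.exp (y ^ 2 / 4)) ∂(gaussianReal 0 1) = ENNReal.ofReal √2 := by
  rw [gaussianReal_of_var_ne_zero _ one_ne_zero,
    lintegral_withDensity_eq_lintegral_mul _ (measurable_gaussianPDF _ _) (by fun_prop)]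
  have h1 (y : ℝ) : (gaussianPDF 0 1 * fun y => ENNReal.ofReal (Real.exp (y ^ 2 / 4))) y =
      ENNReal.ofReal ((√(2 * Real.pi))⁻¹ * Real.exp (-(1 / 4) * y ^ 2)) := by
    simp only [Pi.mul_apply, gaussianPDF, gaussianPDFReal]
    rw [← ENNReal.ofReal_mul (by positivity), mul_assoc _ (Real.exp _), ← Real.exp_add]
    simp only [NNReal.coe_one, mul_one, sub_zero]
    congr 3
    ring
  simp_rw [h1]
  rw [← ofReal_integral_eq_lintegral_ofReal
    ((integrable_exp_neg_mul_sq (by norm_num)).const_mul _)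
    (ae_of_all _ fun y => by positivity), integral_const_mul, integral_gaussian]
  congr 1
  rw [← Real.sqrt_inv, ← Real.sqrt_mul (by positivity)]
  congr 1
  field_simp
  norm_num

theorem lintegral_exp_sq_stdGaussianPi_le {n : ℕ} {w : Fin n → ℝ} (hw : ∑ i, w i ^ 2 ≤ 1 / 4) :
    ∫⁻ g, ENNReal.ofReal (Real.exp ((∑ i, g i * w i) ^ 2)) ∂(stdGaussianPi n) ≤
      ENNReal.ofReal √2 := by
  have hnn : 0 ≤ ∑ i, w i ^ 2 := Finset.sum_nonneg fun i _ => sq_nonneg _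
  rw [← lintegral_map (f := fun y : ℝ => ENNReal.ofReal (Real.exp (y ^ 2)))
    (g := fun g : Fin n → ℝ => ∑ i, g i * w i) (by fun_prop) (by fun_prop),
    stdGaussianPi_map_sum_mul, lintegral_map (by fun_prop) (by fun_prop),
    ← lintegral_exp_sq_div_four_gaussianReal]
  refine lintegral_mono fun y => ENNReal.ofReal_le_ofReal (Real.exp_le_exp.2 ?_)
  rw [mul_pow, Real.sq_sqrt hnn]
  nlinarith [sq_nonneg y]

section PsiTwo

variable {α : Type*} [MeasurableSpace α] {μ : Measure α} {f : α → ℝ}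

theorem psiTwoNorm_nonneg (μ : Measure α) (f : α → ℝ) : 0 ≤ psiTwoNorm μ f :=
  Real.sInf_nonneg fun _ hc => hc.1.le

theorem psiTwoNorm_le_of_lintegral (hf : Measurable f) {c : ℝ} (hc : 0 < c)
    (h : ∫⁻ x, ENNReal.ofReal (Real.exp (f x ^ 2 / c ^ 2)) ∂μ ≤ 2) : psiTwoNorm μ f ≤ c := by
  refine csInf_le ⟨0, fun _ hc => hc.1.le⟩ ⟨hc, ?_⟩
  rw [integral_eq_lintegral_of_nonneg_ae (ae_of_all _ fun x => (Real.exp_pos _).le)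
    (Measurable.aestronglyMeasurable (by fun_prop))]
  exact ENNReal.toReal_mono (by norm_num) h

/-- The `ψ₂` norm is bounded by the exponential square moment. -/
theorem psiTwoNorm_le_toReal_lintegral [IsProbabilityMeasure μ] (hf : Measurable f)
    (h : ∫⁻ x, ENNReal.ofReal (Real.exp (f x ^ 2)) ∂μ ≠ ⊤) :
    psiTwoNorm μ f ≤ (∫⁻ x, ENNReal.ofReal (Real.exp (f x ^ 2)) ∂μ).toReal := by
  set A := (∫⁻ x, ENNReal.ofReal (Real.exp (f x ^ 2)) ∂μ).toReal with hA
  have hA1 : 1 ≤ A := by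
    have : (1 : ENNReal) ≤ ∫⁻ x, ENNReal.ofReal (Real.exp (f x ^ 2)) ∂μ := by
      calc (1 : ENNReal) = ∫⁻ _, 1 ∂μ := by simp
        _ ≤ _ := lintegral_mono fun x => by
          simpa using Real.one_le_exp (sq_nonneg (f x))
    simpa using ENNReal.toReal_mono h this
  refine psiTwoNorm_le_of_lintegral hf (by linarith) ?_
  set θ := (A ^ 2)⁻¹ with hθ
  have hθ0 : 0 ≤ θ := by positivity
  have hθ1 : θ ≤ 1 := inv_le_one_of_one_le₀ (by nlinarith)
  calc ∫⁻ x, ENNReal.ofReal (Real.exp (f x ^ 2 / A ^ 2)) ∂μ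
      ≤ ∫⁻ x, (ENNReal.ofReal (1 - θ) + ENNReal.ofReal θ * ENNReal.ofReal (Real.exp (f x ^ 2)))
          ∂μ := by
        refine lintegral_mono fun x => ?_
        rw [← ENNReal.ofReal_mul hθ0, ← ENNReal.ofReal_add (by linarith) (by positivity)]
        refine ENNReal.ofReal_le_ofReal ?_
        have := convexOn_exp.2 (Set.mem_univ 0) (Set.mem_univ (f x ^ 2))
          (sub_nonneg.2 hθ1) hθ0 (by ring)
        simp only [smul_eq_mul, mul_zero, zero_add, Real.exp_zero, mul_one] at this
        rwa [div_eq_inv_mul]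
    _ = ENNReal.ofReal (1 - θ + θ * A) := by
        rw [lintegral_add_left (by fun_prop), lintegral_const, measure_univ, mul_one,
          lintegral_const_mul _ (by fun_prop), ← ENNReal.ofReal_toReal h, ← hA,
          ← ENNReal.ofReal_mul hθ0, ← ENNReal.ofReal_add (by linarith) (by positivity)]
    _ ≤ 2 := by
        rw [← ENNReal.ofReal_ofNat 2]
        refine ENNReal.ofReal_le_ofReal ?_
        have : θ * A ≤ 1 := by
          rw [hθ, inv_mul_le_iff₀ (by positivity)]
          nlinarith
        linarith

end PsiTwo

section ExpMoment

variable {n : ℕ} {μ : Measure (Fin n → ℝ)} [IsProbabilityMeasure μ]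

theorem measurable_lintegral_exp_sq (μ : Measure (Fin n → ℝ)) [IsProbabilityMeasure μ] :
    Measurable fun v : Fin n → ℝ =>
      ∫⁻ z, ENNReal.ofReal (Real.exp ((∑ i, v i * z i) ^ 2)) ∂μ := by
  refine Measurable.lintegral_prod_right' (ν := μ) (f := fun p : (Fin n → ℝ) × (Fin n → ℝ) =>
    ENNReal.ofReal (Real.exp ((∑ i, p.1 i * p.2 i) ^ 2))) ?_
  fun_prop

theorem convex_lintegral_exp_sq_le (μ : Measure (Fin n → ℝ)) (r : ENNReal) :
    Convex ℝ {v : Fin n → ℝ |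
      ∫⁻ z, ENNReal.ofReal (Real.exp ((∑ i, v i * z i) ^ 2)) ∂μ ≤ r} := by
  intro v hv w hw a b ha hb hab
  simp only [Set.mem_ofPred_eq] at hv hw ⊢
  calc _ ≤ ∫⁻ z, (ENNReal.ofReal a * ENNReal.ofReal (Real.exp ((∑ i, v i * z i) ^ 2)) +
          ENNReal.ofReal b * ENNReal.ofReal (Real.exp ((∑ i, w i * z i) ^ 2))) ∂μ := by
        refine lintegral_mono fun z => ?_
        rw [← ENNReal.ofReal_mul ha, ← ENNReal.ofReal_mul hb,
          ← ENNReal.ofReal_add (by positivity) (by positivity)]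
        refine ENNReal.ofReal_le_ofReal ?_
        have h1 : ∑ i, (a • v + b • w) i * z i =
            a * ∑ i, v i * z i + b * ∑ i, w i * z i := by
          simp only [Pi.add_apply, Pi.smul_apply, smul_eq_mul, add_mul, Finset.sum_add_distrib,
            Finset.mul_sum, mul_assoc]
        have h2 := (even_two.convexOn_pow (𝕜 := ℝ)).2 (Set.mem_univ (∑ i, v i * z i))
          (Set.mem_univ (∑ i, w i * z i)) ha hb hab
        have h3 := convexOn_exp.2 (Set.mem_univ ((∑ i, v i * z i) ^ 2))
          (Set.mem_univ ((∑ i, w i * z i) ^ 2)) ha hb hab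
        rw [h1]
        exact (Real.exp_le_exp.2 h2).trans h3
    _ = ENNReal.ofReal a * ∫⁻ z, ENNReal.ofReal (Real.exp ((∑ i, v i * z i) ^ 2)) ∂μ +
          ENNReal.ofReal b * ∫⁻ z, ENNReal.ofReal (Real.exp ((∑ i, w i * z i) ^ 2)) ∂μ := by
        rw [lintegral_add_left (by fun_prop), lintegral_const_mul _ (by fun_prop),
          lintegral_const_mul _ (by fun_prop)]
    _ ≤ ENNReal.ofReal a * r + ENNReal.ofReal b * r := by gcongr
    _ = r := by rw [← add_mul, ← ENNReal.ofReal_add ha hb, hab, ENNReal.ofReal_one, one_mul]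

theorem lintegral_lintegral_exp_sq_le {M : ℝ} (hM : 0 < M)
    (hμ : ∀ᵐ x ∂μ, √(∑ i, x i ^ 2) ≤ M) :
    ∫⁻ g, ∫⁻ z, ENNReal.ofReal (Real.exp ((∑ i, ((2 * M)⁻¹ • g) i * z i) ^ 2)) ∂μ
      ∂(stdGaussianPi n) ≤ ENNReal.ofReal √2 := by
  rw [lintegral_lintegral_swap (Measurable.aemeasurable (by fun_prop))]
  calc _ ≤ ∫⁻ _, ENNReal.ofReal √2 ∂μ := by
        refine lintegral_mono_ae ?_
        filter_upwards [hμ] with z hz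
        have hw : ∑ i, ((2 * M)⁻¹ * z i) ^ 2 ≤ 1 / 4 := by
          rw [Real.sqrt_le_left hM.le] at hz
          simp only [mul_pow, ← Finset.mul_sum]
          rw [inv_pow, inv_mul_le_iff₀ (by positivity)]
          linarith
        convert lintegral_exp_sq_stdGaussianPi_le hw using 6 with g
        refine Finset.sum_congr rfl fun i _ => ?_
        simp only [Pi.smul_apply, smul_eq_mul]
        ring
    _ = _ := by simp

/-- The exponential square moment of `⟨G, ·⟩ / (2M)` is at most `2` with probability at
least `1 / 4`. -/
theorem one_quarter_le_stdGaussianPi_real {M : ℝ} (hM : 0 < M)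
    (hμ : ∀ᵐ x ∂μ, √(∑ i, x i ^ 2) ≤ M) :
    1 / 4 ≤ (stdGaussianPi n).real {g | ∫⁻ z, ENNReal.ofReal
      (Real.exp ((∑ i, ((2 * M)⁻¹ • g) i * z i) ^ 2)) ∂μ ≤ 2} := by
  set A : (Fin n → ℝ) → ENNReal := fun g =>
    ∫⁻ z, ENNReal.ofReal (Real.exp ((∑ i, ((2 * M)⁻¹ • g) i * z i) ^ 2)) ∂μ
  have hAm : Measurable A := (measurable_lintegral_exp_sq μ).comp (measurable_const_smul _)
  have hS : MeasurableSet {g | A g ≤ 2} := measurableSet_le hAm measurable_const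
  have h1 : 2 * stdGaussianPi n {g | 2 ≤ A g} ≤ ENNReal.ofReal √2 :=
    (mul_meas_ge_le_lintegral hAm 2).trans (lintegral_lintegral_exp_sq_le hM hμ)
  have h2 := ENNReal.toReal_mono ENNReal.ofReal_ne_top h1
  rw [ENNReal.toReal_mul, ENNReal.toReal_ofReal (by positivity), ENNReal.toReal_ofNat,
    ← measureReal_def] at h2
  have h3 : (stdGaussianPi n).real {g | A g ≤ 2}ᶜ ≤ (stdGaussianPi n).real {g | 2 ≤ A g} :=
    measureReal_mono fun g hg => by
      simp only [Set.mem_compl_iff, Set.mem_ofPred_eq, not_le] at hg ⊢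
      exact hg.le
  rw [probReal_compl_eq_one_sub hS] at h3
  have h4 : √2 ≤ 3 / 2 := by
    rw [Real.sqrt_le_left (by norm_num)]
    norm_num
  linarith

theorem integral_psiTwoNorm_le {M : ℝ} (hM : 0 < M) (hμ : ∀ᵐ x ∂μ, √(∑ i, x i ^ 2) ≤ M) :
    ∫ g, psiTwoNorm μ (fun x => (∑ i, g i * x i) / (2 * M)) ∂(stdGaussianPi n) ≤ √2 := by
  set A : (Fin n → ℝ) → ENNReal := fun g =>
    ∫⁻ z, ENNReal.ofReal (Real.exp ((∑ i, ((2 * M)⁻¹ • g) i * z i) ^ 2)) ∂μ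
  have hAm : Measurable A := (measurable_lintegral_exp_sq μ).comp (measurable_const_smul _)
  have hint : ∫⁻ g, A g ∂(stdGaussianPi n) ≤ ENNReal.ofReal √2 :=
    lintegral_lintegral_exp_sq_le hM hμ
  have hfin : ∫⁻ g, A g ∂(stdGaussianPi n) ≠ ⊤ := (hint.trans_lt ENNReal.ofReal_lt_top).ne
  have hlt := ae_lt_top hAm hfin
  calc _ ≤ ∫ g, (A g).toReal ∂(stdGaussianPi n) := by
        refine integral_mono_of_nonneg (ae_of_all _ fun g => psiTwoNorm_nonneg _ _)
          (integrable_toReal_of_lintegral_ne_top hAm.aemeasurable hfin) ?_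
        filter_upwards [hlt] with g hg
        have h1 : A g =
            ∫⁻ z, ENNReal.ofReal (Real.exp (((∑ i, g i * z i) / (2 * M)) ^ 2)) ∂μ := by
          refine lintegral_congr fun z => ?_
          simp only [Pi.smul_apply, smul_eq_mul, mul_assoc, ← Finset.mul_sum, div_eq_inv_mul]
        rw [h1] at hg ⊢
        exact psiTwoNorm_le_toReal_lintegral (by fun_prop) hg.ne
    _ = (∫⁻ g, A g ∂(stdGaussianPi n)).toReal := integral_toReal hAm.aemeasurable hlt
    _ ≤ √2 := by
        have := ENNReal.toReal_mono ENNReal.ofReal_ne_top hint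
        rwa [ENNReal.toReal_ofReal (by positivity)] at this

theorem exists_psiTwoNorm_cover {M : ℝ} (hM : 0 < M) (hμ : ∀ᵐ x ∂μ, √(∑ i, x i ^ 2) ≤ M)
    {ε : ℝ} (hε : 0 < ε) :
    ∃ T : Finset (Fin n → ℝ), (T.card : ℝ) ≤ 4 * Real.exp (8 * M ^ 2 / ε ^ 2) ∧
      ∀ x : Fin n → ℝ, ∑ i, x i ^ 2 ≤ 1 →
        ∃ y ∈ T, psiTwoNorm μ (fun z => ∑ i, (x i - y i) * z i) ≤ ε := by
  set S : Set (Fin n → ℝ) := {g | ∫⁻ z, ENNReal.ofReal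
    (Real.exp ((∑ i, ((2 * M)⁻¹ • g) i * z i) ^ 2)) ∂μ ≤ 2} with hS
  have hSm : MeasurableSet S :=
    measurableSet_le ((measurable_lintegral_exp_sq μ).comp (measurable_const_smul _))
      measurable_const
  have hconv : Convex ℝ S :=
    (convex_lintegral_exp_sq_le μ 2).is_linear_preimage
      (LinearMap.lsmul ℝ (Fin n → ℝ) (2 * M)⁻¹).isLinear
  have hsymm : ∀ y ∈ S, -y ∈ S := by
    intro y hy
    simpa [hS] using hy
  obtain ⟨T, hT, hcov⟩ := exists_cover_of_convex_symmetric hSm hsymm hconv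
    (one_quarter_le_stdGaussianPi_real hM hμ) (4 * M / ε)
  refine ⟨T, hT.trans_eq (by congr 2; ring), fun x hx => ?_⟩
  obtain ⟨y, hy, hxy⟩ := hcov x hx
  refine ⟨y, hy, psiTwoNorm_le_of_lintegral (by fun_prop) hε (le_of_eq_of_le ?_ hxy)⟩
  refine lintegral_congr fun z => ?_
  rw [← div_pow, Finset.sum_div]
  congr 4 with i
  simp only [Pi.smul_apply, Pi.sub_apply, smul_eq_mul]
  field_simp
  ring

theorem psiTwoNorm_inner_le {M : ℝ} (hM : 0 < M) (hμ : ∀ᵐ x ∂μ, √(∑ i, x i ^ 2) ≤ M)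
    {ε : ℝ} (hε : 0 < ε) (hMε : M ^ 2 ≤ ε ^ 2 * Real.log 2) {v : Fin n → ℝ}
    (hv : ∑ i, v i ^ 2 ≤ 1) : psiTwoNorm μ (fun z => ∑ i, v i * z i) ≤ ε := by
  refine psiTwoNorm_le_of_lintegral (by fun_prop) hε ?_
  calc _ ≤ ∫⁻ _, 2 ∂μ := by
        refine lintegral_mono_ae ?_
        filter_upwards [hμ] with z hz
        rw [Real.sqrt_le_left hM.le] at hz
        rw [← ENNReal.ofReal_ofNat 2]
        refine ENNReal.ofReal_le_ofReal ?_
        rw [← Real.le_log_iff_exp_le (by norm_num), div_le_iff₀' (by positivity)]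
        have h1 := Finset.sum_mul_sq_le_sq_mul_sq Finset.univ v z
        have h2 : 0 ≤ ∑ i, z i ^ 2 := Finset.sum_nonneg fun i _ => sq_nonneg _
        nlinarith
    _ = 2 := by simp

end ExpMoment

/-- dual-Sudakov entropy estimate for the `ψ₂`-ball of an unconditional
measure: (1) the Gaussian average of `ψ₂` norms of `⟨G,·⟩/(cM)` is at most 2;
(2) `log N(B_2^n, ε B_{ψ₂}) ≤ C M^2/ε^2`, expressed via the existence of a covering
of cardinality at most `exp(C M^2/ε^2)`. -/
theorem dual_sudakov_psi2_entropy :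
    ∃ c C : ℝ, 0 < c ∧ 0 < C ∧
      ∀ (n : ℕ), 0 < n → ∀ (μ : Measure (Fin n → ℝ)), IsProbabilityMeasure μ →
        IsUncondMeasure μ →
        ∀ M : ℝ, 0 < M →
          (∀ᵐ x ∂μ, Real.sqrt (∑ i, x i ^ 2) ≤ M) →
          ((∫ g, psiTwoNorm μ (fun x => (∑ i, g i * x i) / (c * M))
              ∂(Measure.pi fun _ : Fin n => gaussianReal 0 1)) ≤ 2
          ∧ ∀ ε : ℝ, 0 < ε →
              ∃ T : Finset (Fin n → ℝ),
                (T.card : ℝ) ≤ Real.exp (C * M ^ 2 / ε ^ 2) ∧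
                {x : Fin n → ℝ | ∑ i, x i ^ 2 ≤ 1} ⊆
                  ⋃ t ∈ T, {x | psiTwoNorm μ (fun z => ∑ i, (x i - t i) * z i) ≤ ε}) := by
  refine ⟨2, 10, by norm_num, by norm_num, fun n _ μ _ _ M hM hμ => ⟨?_, fun ε hε => ?_⟩⟩
  · exact (integral_psiTwoNorm_le hM hμ).trans
      ((Real.sqrt_le_left (by norm_num)).2 (by norm_num))
  rcases le_or_gt (M ^ 2) (ε ^ 2 * Real.log 2) with h | h
  · refine ⟨{0}, ?_, fun x hx => ?_⟩
    · simpa using by positivity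
    · simpa using psiTwoNorm_inner_le hM hμ hε h hx
  · obtain ⟨T, hT, hcov⟩ := exists_psiTwoNorm_cover hM hμ hε
    refine ⟨T, hT.trans ?_, fun x hx => ?_⟩
    · have h2 : 2 ≤ Real.exp (M ^ 2 / ε ^ 2) := by
        rw [← Real.log_le_iff_le_exp (by norm_num), le_div_iff₀' (by positivity)]
        exact h.le
      have h3 : 10 * M ^ 2 / ε ^ 2 = M ^ 2 / ε ^ 2 + M ^ 2 / ε ^ 2 + 8 * M ^ 2 / ε ^ 2 := by ring
      rw [h3, Real.exp_add, Real.exp_add]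
      gcongr
      nlinarith
    · obtain ⟨y, hy, hxy⟩ := hcov x hx
      exact Set.mem_biUnion hy hxy
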